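/- arXiv:math/0010228 — 8 statements merged into one kernel-verified Lean document; each statement's English description precedes it below -/
import Mathlib

section
/- Let T be a nonempty noetherian topological space and I a totally ordered set. A function γ : T → I is an LC-function if and only if γ takes only finitely many values and is upper semicontinuous, i.e. for every α ∈ I the set {x ∈ T : γ(x) ≥ α} is closed in T. -/
open TopologicalSpace

/-- A function `γ` from a topological space `T` to a partially ordered set `I` is an
LC-function if for every irreducible closed subset `Z` of `T` there is a dense open
subset `U` of `Z` (in the subspace topology) on which `γ` is constant, with constant
value `γ₁`, and such that `γ₁ ≤ γ x` for every `x ∈ Z`. -/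
def IsLCFunction {T : Type*} [TopologicalSpace T] {I : Type*} [Preorder I] (γ : T → I) : Prop :=
  ∀ Z : Set T, IsClosed Z → IsIrreducible Z →
    ∃ (γ₁ : I) (U : Set Z), IsOpen U ∧ Dense U ∧
      (∀ x ∈ U, γ (x : T) = γ₁) ∧ ∀ x ∈ Z, γ₁ ≤ γ x

/-- Noetherian induction on closed sets: a property of closed sets that is stable under binary
unions holds for all of them once it passes from the proper closed subsets of an irreducible
closed set to the set itself. -/
theorem TopologicalSpace.NoetherianSpace.isClosed_induction {T : Type*} [TopologicalSpace T]
    [NoetherianSpace T] {P : Set T → Prop} (empty : P ∅)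
    (union : ∀ A B : Set T, P A → P B → P (A ∪ B))
    (irreducible : ∀ Y : Set T, IsClosed Y → IsIrreducible Y →
      (∀ W : Set T, IsClosed W → W ⊂ Y → P W) → P Y)
    {Z : Set T} (hZ : IsClosed Z) : P Z := by
  suffices h : ∀ Z : Closeds T, P Z from h ⟨Z, hZ⟩
  intro Z
  induction Z using WellFoundedLT.induction with
  | ind Z ih =>
    obtain ⟨S, hS, hc, hi, hZS⟩ :=
      NoetherianSpace.exists_finite_set_isClosed_irreducible Z.isClosed
    have hP : ∀ Y ∈ S, P Y := fun Y hY ↦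
      irreducible Y (hc Y hY) (hi Y hY) fun W hW hWY ↦
        ih ⟨W, hW⟩ (hWY.trans_subset (hZS ▸ Set.subset_sUnion_of_mem hY))
    rw [hZS]
    clear hZS hc hi
    induction S, hS using Set.Finite.induction_on with
    | empty => simpa using empty
    | @insert Y S _ _ ihS =>
      rw [Set.sUnion_insert]
      exact union _ _ (hP Y (Set.mem_insert _ _))
        (ihS fun X hX ↦ hP X (Set.mem_insert_of_mem _ hX))

namespace IsLCFunction

section Preorder

variable {T : Type*} [TopologicalSpace T] {I : Type*} [Preorder I] {γ : T → I}

theorem exists_isClosed_ssubset (h : IsLCFunction γ) {Y : Set T} (hc : IsClosed Y)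
    (hi : IsIrreducible Y) :
    ∃ (γ₁ : I) (W : Set T), IsClosed W ∧ W ⊂ Y ∧ (∀ x ∈ Y, x ∉ W → γ x = γ₁) ∧
      ∀ x ∈ Y, γ₁ ≤ γ x := by
  obtain ⟨γ₁, U, hU, hd, hconst, hle⟩ := h Y hc hi
  have : Nonempty Y := hi.nonempty.to_subtype
  obtain ⟨⟨y, hy⟩, hyU⟩ := hd.nonempty
  obtain ⟨V, hV, rfl⟩ := isOpen_induced_iff.mp hU
  refine ⟨γ₁, Y \ V, hc.sdiff hV, ⟨Set.sdiff_subset, fun hsub ↦ (hsub hy).2 hyU⟩, ?_, hle⟩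
  intro x hx hxW
  exact hconst ⟨x, hx⟩ (by_contra fun hxV ↦ hxW ⟨hx, hxV⟩)

theorem finite_range [NoetherianSpace T] (h : IsLCFunction γ) : (Set.range γ).Finite := by
  rw [← Set.image_univ]
  refine NoetherianSpace.isClosed_induction (P := fun Z ↦ (γ '' Z).Finite) (by simp)
    (fun A B hA hB ↦ by simpa only [Set.image_union] using hA.union hB) ?_ isClosed_univ
  intro Y hc hi ih
  obtain ⟨γ₁, W, hW, hWY, hconst, -⟩ := h.exists_isClosed_ssubset hc hi
  refine ((ih W hW hWY).insert γ₁).subset ?_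
  rintro _ ⟨x, hx, rfl⟩
  by_cases hxW : x ∈ W
  · exact Or.inr ⟨x, hxW, rfl⟩
  · exact Or.inl (hconst x hx hxW)

theorem isClosed_setOf_le [NoetherianSpace T] (h : IsLCFunction γ) (α : I) :
    IsClosed {x : T | α ≤ γ x} := by
  rw [← Set.univ_inter {x : T | α ≤ γ x}]
  refine NoetherianSpace.isClosed_induction
    (P := fun Z ↦ IsClosed (Z ∩ {x : T | α ≤ γ x})) (by simp)
    (fun A B hA hB ↦ by simpa only [Set.union_inter_distrib_right] using hA.union hB)
    ?_ isClosed_univ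
  intro Y hc hi ih
  obtain ⟨γ₁, W, hW, hWY, hconst, hle⟩ := h.exists_isClosed_ssubset hc hi
  by_cases hα : α ≤ γ₁
  · have hsub : Y ⊆ {x : T | α ≤ γ x} := fun x hx ↦ hα.trans (hle x hx)
    rwa [Set.inter_eq_left.mpr hsub]
  · convert ih W hW hWY using 1
    refine Set.Subset.antisymm (fun x hx ↦ ⟨?_, hx.2⟩) (Set.inter_subset_inter_left _ hWY.1)
    by_contra hxW
    exact hα (hconst x hx.1 hxW ▸ hx.2)

end Preorder

theorem of_finite_range_of_isClosed {T : Type*} [TopologicalSpace T] {I : Type*} [LinearOrder I]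
    {γ : T → I} (hfin : (Set.range γ).Finite) (hclosed : ∀ α : I, IsClosed {x : T | α ≤ γ x}) :
    IsLCFunction γ := by
  intro Z _ hi
  have : IrreducibleSpace Z := Subtype.irreducibleSpace hi
  obtain ⟨z, hz, hmin⟩ := Set.exists_min_image (γ '' Z) id
    (hfin.subset (Set.image_subset_range γ Z)) (hi.nonempty.image γ)
  obtain ⟨y, hy, rfl⟩ := hz
  have hle : ∀ x ∈ Z, γ y ≤ γ x := fun x hx ↦ hmin _ ⟨x, hx, rfl⟩
  have hC : IsClosed {x : T | γ y < γ x} := by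
    have : {x : T | γ y < γ x} = ⋃ α ∈ Set.range γ ∩ Set.Ioi (γ y), {x : T | α ≤ γ x} := by
      ext x
      simp only [Set.mem_ofPred_eq, Set.mem_iUnion, exists_prop]
      exact ⟨fun hx ↦ ⟨γ x, ⟨⟨x, rfl⟩, hx⟩, le_rfl⟩, fun ⟨α, hα, hx⟩ ↦ lt_of_lt_of_le hα.2 hx⟩
    rw [this]
    exact (hfin.inter_of_left _).isClosed_biUnion fun α _ ↦ hclosed α
  have hU : IsOpen (Subtype.val ⁻¹' {x : T | γ y < γ x}ᶜ : Set Z) :=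
    hC.isOpen_compl.preimage continuous_subtype_val
  exact ⟨γ y, _, hU, hU.dense ⟨⟨y, hy⟩, lt_irrefl (γ y)⟩,
    fun x hx ↦ le_antisymm (not_lt.mp hx) (hle x x.2), hle⟩

end IsLCFunction

/-- On a nonempty noetherian topological space, with values in a totally ordered set,
a function is an LC-function iff it takes finitely many values and is upper
semicontinuous (all sets `{x | α ≤ γ x}` are closed). -/
theorem isLCFunction_iff_finite_range_and_upperSemicontinuous
    {T : Type*} [TopologicalSpace T] [Nonempty T] [NoetherianSpace T]
    {I : Type*} [LinearOrder I] (γ : T → I) :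
    IsLCFunction γ ↔ (Set.range γ).Finite ∧ ∀ α : I, IsClosed {x : T | α ≤ γ x} := by
  exact ⟨fun h ↦ ⟨h.finite_range, h.isClosed_setOf_le⟩,
    fun h ↦ IsLCFunction.of_finite_range_of_isClosed h.1 h.2⟩
end

section
/- Let (R, M) be a regular local ring of Krull dimension n, and let x_1, …, x_n be a regular system of parameters of R (so x_1, …, x_n generate M). Let 1 ≤ r < s ≤ n, set P = (x_1, …, x_r) and Q = (x_s, …, x_n), and let R̄ = R/Q, a regular local ring with maximal ideal M̄ = M/Q. Let b ≥ 1 and let I be an ideal of R with I ⊆ P^b and I ⊄ M^{b+1}. Then the image ideal Ī = I·R̄ satisfies Ī ⊆ M̄^b and Ī ⊄ M̄^{b+1}; that is, the order of Ī in R̄ is exactly b. -/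
open IsLocalRing

universe u

/-- An element of the `b`-th power of the ideal generated by a finite family is the value of a
homogeneous polynomial of degree `b` at that family. -/
theorem Ideal.exists_isHomogeneous_eval_eq_of_mem_span_range_pow {R σ : Type*} [CommRing R]
    [Finite σ] (z : σ → R) (b : ℕ) {f : R} (hf : f ∈ Ideal.span (Set.range z) ^ b) :
    ∃ F : MvPolynomial σ R, F.IsHomogeneous b ∧ MvPolynomial.eval z F = f := by
  have := Fintype.ofFinite σ
  induction b generalizing f with
  | zero => exact ⟨MvPolynomial.C f, MvPolynomial.isHomogeneous_C _ _, by simp⟩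
  | succ b ih =>
    rw [pow_succ] at hf
    induction hf using Submodule.mul_induction_on' with
    | mem_mul_mem a ha c hc =>
      obtain ⟨F, hF, rfl⟩ := ih ha
      obtain ⟨d, rfl⟩ := Ideal.mem_span_range_iff_exists_fun.mp hc
      refine ⟨F * ∑ i, MvPolynomial.C (d i) * MvPolynomial.X i,
        hF.mul (MvPolynomial.IsHomogeneous.sum _ _ _ fun i _ => ?_), by simp⟩
      simpa using (MvPolynomial.isHomogeneous_C σ (d i)).mul (MvPolynomial.isHomogeneous_X R i)
    | add a _ c _ ha hc =>
      obtain ⟨F, hF, rfl⟩ := ha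
      obtain ⟨G, hG, rfl⟩ := hc
      exact ⟨F + G, hF.add hG, by simp⟩

/-- Every prime ideal of a local ring is the support of a valuation whose ring dominates it. -/
theorem IsLocalRing.exists_valuation_supp_eq {R : Type u} [CommRing R] [IsLocalRing R]
    (p : Ideal R) [p.IsPrime] :
    ∃ (Γ₀ : Type u) (_ : LinearOrderedCommGroupWithZero Γ₀) (v : Valuation R Γ₀),
      (∀ a, v a ≤ 1) ∧ (∀ a ∈ maximalIdeal R, v a < 1) ∧ v.supp = p := by
  let φ : R →+* FractionRing (R ⧸ p) :=
    (algebraMap (R ⧸ p) (FractionRing (R ⧸ p))).comp (Ideal.Quotient.mk p)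
  obtain ⟨A, hA, hloc⟩ := IsLocalRing.exists_factor_valuationRing φ
  refine ⟨A.ValueGroup, inferInstance, A.valuation.comap φ, fun a => ?_, fun a ha => ?_, ?_⟩
  · exact A.valuation_le_one ⟨φ a, hA a⟩
  · refine (A.valuation_lt_one_iff ⟨φ a, hA a⟩).mp ?_
    exact fun hu => ha (hloc.map_nonunit a hu)
  · ext a
    simp [Valuation.mem_supp_iff, φ, Ideal.Quotient.eq_zero_iff_mem]

/-- A valuation bounded by `γ` on an ideal is bounded by `γ ^ k` on its `k`-th power. -/
theorem Valuation.map_le_pow_of_mem_pow {R Γ₀ : Type*} [CommRing R]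
    [LinearOrderedCommGroupWithZero Γ₀] (v : Valuation R Γ₀) (hv : ∀ a, v a ≤ 1)
    {I : Ideal R} {γ : Γ₀} (hI : ∀ a ∈ I, v a ≤ γ) (k : ℕ) {a : R} (ha : a ∈ I ^ k) :
    v a ≤ γ ^ k := by
  induction k generalizing a with
  | zero => simpa using hv a
  | succ k ih =>
    rw [pow_succ] at ha
    induction ha using Submodule.mul_induction_on' with
    | mem_mul_mem a ha c hc =>
      rw [map_mul, pow_succ]
      exact mul_le_mul' (ih ha) (hI c hc)
    | add a _ c _ ha hc => exact v.map_add_le ha hc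

/-- In a noetherian local ring of dimension `n`, a family of `n` non-units one of which vanishes
is contained in a non-maximal prime. -/
theorem IsLocalRing.exists_isPrime_ne_maximalIdeal {R : Type*} [CommRing R] [IsLocalRing R]
    [IsNoetherianRing R] {n : ℕ} (hdim : ringKrullDim R = n) (y : Fin n → R)
    (hy : ∀ i, y i ∈ maximalIdeal R) (j : Fin n) (hj : y j = 0) :
    ∃ p : Ideal R, p.IsPrime ∧ p ≠ maximalIdeal R ∧ ∀ i, y i ∈ p := by
  classical
  let t : Finset R := (Finset.univ.erase j).image y
  have hle : Ideal.span (t : Set R) ≤ maximalIdeal R := by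
    rw [Ideal.span_le]
    intro a ha
    obtain ⟨i, -, rfl⟩ := Finset.mem_image.mp (Finset.mem_coe.mp ha)
    exact hy i
  obtain ⟨p, hp, hpM⟩ := Ideal.exists_minimalPrimes_le hle
  refine ⟨p, hp.isPrime, ?_, fun i => ?_⟩
  · rintro rfl
    have h1 := Ideal.height_le_card_of_mem_minimalPrimes_span_finset hp
    have h2 : ((maximalIdeal R).height : WithBot ℕ∞) = n := by
      rw [IsLocalRing.maximalIdeal_height_eq_ringKrullDim, hdim]
    have h3 : (maximalIdeal R).height = n := by exact_mod_cast h2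
    rw [h3] at h1
    have h4 : n ≤ t.card := by exact_mod_cast h1
    have h5 : t.card ≤ n - 1 := Finset.card_image_le.trans (by simp)
    have := j.pos
    omega
  · by_cases hij : i = j
    · rw [hij, hj]
      exact p.zero_mem
    · exact hp.le (Ideal.subset_span (Finset.mem_coe.mpr
        (Finset.mem_image_of_mem y (by simpa using hij))))

/-- Uniqueness of digits: exponent vectors of degree `b` are separated by the weights `B ^ i`
when `b < B`. -/
theorem Finsupp.eq_of_sum_mul_pow_eq {r b B : ℕ} (hB : 1 < B) (hbB : b < B) {m m' : Fin r →₀ ℕ}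
    (hm : m.degree = b) (hm' : m'.degree = b)
    (h : ∑ i, m i * B ^ (i : ℕ) = ∑ i, m' i * B ^ (i : ℕ)) : m = m' := by
  have hlt : ∀ k : Fin r →₀ ℕ, k.degree = b → ∀ l ∈ List.ofFn k, l < B := by
    intro k hk l hl
    obtain ⟨i, rfl⟩ := (List.mem_ofFn' _ _).mp hl
    exact (hk ▸ Finsupp.le_degree i k).trans_lt hbB
  refine Finsupp.ext <| congrFun <| List.ofFn_inj.mp ?_
  apply Nat.ofDigits_inj_of_len_eq hB (by simp) (hlt m hm) (hlt m' hm')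
  simpa only [Nat.ofDigits_eq_sum_mapIdx, List.mapIdx_eq_ofFn, List.get_ofFn, List.length_ofFn,
    Fin.val_cast, mul_comm, List.sum_ofFn] using! h

/-- A homogeneous polynomial of degree `b` with a unit coefficient takes a large value at a family
whose valuations are powers of `g` with exponents separating the monomials of degree `b`. -/
theorem Valuation.pow_lt_map_eval_of_isHomogeneous {R Γ₀ σ : Type*} [CommRing R] [IsLocalRing R]
    [LinearOrderedCommGroupWithZero Γ₀] [Fintype σ] (v : Valuation R Γ₀) (hv : ∀ a, v a ≤ 1)
    {g : Γ₀} (hg0 : 0 < g) (hg1 : g < 1) {A b : ℕ} (ω : σ → ℕ) (hA : ∀ i, A ≤ ω i)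
    (hlt : ∀ m : σ →₀ ℕ, m.degree = b → ∑ i, m i * ω i < A * (b + 1))
    (hinj : ∀ m m' : σ →₀ ℕ, m.degree = b → m'.degree = b →
      ∑ i, m i * ω i = ∑ i, m' i * ω i → m = m')
    (hvM : ∀ a ∈ maximalIdeal R, v a ≤ g ^ A) (z : σ → R) (hz : ∀ i, v (z i) = g ^ ω i)
    (F : MvPolynomial σ R) (hF : F.IsHomogeneous b)
    (hcoeff : ∃ m, F.coeff m ∉ maximalIdeal R) :
    g ^ (A * (b + 1)) < v (MvPolynomial.eval z F) := by
  classical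
  have hdeg : ∀ m ∈ F.support, m.degree = b := fun m hm => by
    have := hF (MvPolynomial.mem_support_iff.mp hm)
    rwa [Finsupp.degree_eq_weight_one]
  have hterm : ∀ m, v (F.coeff m * ∏ i, z i ^ m i) = v (F.coeff m) * g ^ (∑ i, m i * ω i) := by
    intro m
    simp only [map_mul, map_prod, map_pow, hz, ← pow_mul, Finset.prod_pow_eq_pow_sum, mul_comm]
  have hunit : ∀ a : R, a ∉ maximalIdeal R → v a = 1 := by
    intro a ha
    obtain ⟨c, hc⟩ := (notMem_maximalIdeal.mp ha).exists_right_inv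
    refine le_antisymm (hv a) ?_
    calc (1 : Γ₀) = v a * v c := by rw [← map_mul, hc, map_one]
      _ ≤ v a * 1 := mul_le_mul_right (hv c) _
      _ = v a := mul_one _
  obtain ⟨m₀, hm₀, hmin⟩ := (F.support.filter fun m => F.coeff m ∉ maximalIdeal R).exists_min_image
    (fun m => ∑ i, m i * ω i) (by
      obtain ⟨m, hm⟩ := hcoeff
      refine ⟨m, Finset.mem_filter.mpr ⟨MvPolynomial.mem_support_iff.mpr fun h => hm ?_, hm⟩⟩
      rw [h]
      exact Ideal.zero_mem _)
  obtain ⟨hm₀s, hm₀u⟩ := Finset.mem_filter.mp hm₀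
  have hval : v (MvPolynomial.eval z F) = g ^ (∑ i, m₀ i * ω i) := by
    rw [MvPolynomial.eval_eq', v.map_sum_eq_of_lt hm₀s, hterm, hunit _ hm₀u, one_mul]
    intro m hm
    obtain ⟨hms, hne⟩ := Finset.mem_sdiff.mp hm
    rw [Finset.mem_singleton] at hne
    rw [hterm, hterm, hunit _ hm₀u, one_mul]
    by_cases hmu : F.coeff m ∈ maximalIdeal R
    · calc v (F.coeff m) * g ^ (∑ i, m i * ω i) ≤ g ^ A * g ^ (∑ i, m i * ω i) :=
            mul_le_mul_left (hvM _ hmu) _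
        _ = g ^ (A + ∑ i, m i * ω i) := (pow_add _ _ _).symm
        _ < g ^ (∑ i, m₀ i * ω i) := by
            refine pow_lt_pow_right_of_lt_one₀ hg0 hg1 ((hlt m₀ (hdeg m₀ hm₀s)).trans_le ?_)
            have : b * A ≤ ∑ i, m i * ω i := by
              rw [← hdeg m hms, Finsupp.degree_eq_sum, Finset.sum_mul]
              exact Finset.sum_le_sum fun i _ => Nat.mul_le_mul_left _ (hA i)
            linarith
    · rw [hunit _ hmu, one_mul]
      refine pow_lt_pow_right_of_lt_one₀ hg0 hg1 ((hmin m ?_).lt_of_ne fun h => hne ?_)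
      · exact Finset.mem_filter.mpr ⟨hms, hmu⟩
      · exact (hinj m₀ m (hdeg m₀ hm₀s) (hdeg m hms) h).symm
  rw [hval]
  exact pow_lt_pow_right_of_lt_one₀ hg0 hg1 (hlt m₀ (hdeg m₀ hm₀s))

/-- Given a regular system of parameters and positive weights `ω`, there is a valuation which
is `g ^ ω i` on the parameters of index `< k` and vanishes on the others. -/
theorem IsLocalRing.exists_valuation_eq_pow {R : Type u} [CommRing R] [IsLocalRing R]
    [IsNoetherianRing R] {n : ℕ} (hdim : ringKrullDim R = n) (x : Fin n → R)
    (hgen : Ideal.span (Set.range x) = maximalIdeal R) (k : ℕ) (hk : 0 < k) (hkn : k ≤ n)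
    (ω : ℕ → ℕ) (hω : ∀ i, ω i ≠ 0) :
    ∃ (Γ₀ : Type u) (_ : LinearOrderedCommGroupWithZero Γ₀) (v : Valuation R Γ₀) (g : Γ₀),
      0 < g ∧ g < 1 ∧ (∀ a, v a ≤ 1) ∧ (∀ i : Fin n, (i : ℕ) < k → v (x i) = g ^ ω i) ∧
        ∀ i : Fin n, k ≤ (i : ℕ) → v (x i) = 0 := by
  have hxM : ∀ i, x i ∈ maximalIdeal R := fun i => hgen ▸ Ideal.subset_span ⟨i, rfl⟩
  let j : Fin n := ⟨0, hk.trans_le hkn⟩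
  let y : Fin n → R := fun i => if (i : ℕ) < k then x i ^ ω 0 - x j ^ ω i else x i
  obtain ⟨p, hp, hpM, hyp⟩ := exists_isPrime_ne_maximalIdeal hdim y
    (fun i => by
      simp only [y]
      split_ifs
      · exact sub_mem (Ideal.pow_mem_of_mem _ (hxM i) _ (hω 0).bot_lt)
          (Ideal.pow_mem_of_mem _ (hxM j) _ (hω i).bot_lt)
      · exact hxM i) j (by simp [y, j, hk])
  obtain ⟨Γ₀, inst, v, hv, hvM, hsupp⟩ := exists_valuation_supp_eq p
  have hxlt : ∀ i : Fin n, (i : ℕ) < k → v (x i) ^ ω 0 = v (x j) ^ ω i := by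
    intro i hi
    have h := hyp i
    simp only [y, if_pos hi, ← hsupp] at h
    rw [← map_pow, ← map_pow, ← v.map_add_supp (x j ^ ω i) h]
    congr 1
    ring
  have hxge : ∀ i : Fin n, k ≤ (i : ℕ) → v (x i) = 0 := by
    intro i hi
    have h := hyp i
    simp only [y, if_neg hi.not_gt, ← hsupp] at h
    exact h
  refine ⟨Γ₀, inst, v.map (powMonoidWithZeroHom (hω 0)) (fun a c h => pow_le_pow_left' h _),
    v (x j), zero_lt_iff.mpr fun h0 => hpM ?_, hvM _ (hxM j), fun a => ?_, fun i hi => ?_,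
    fun i hi => ?_⟩
  · refine le_antisymm (le_maximalIdeal hp.ne_top) ?_
    rw [← hgen, Ideal.span_le, ← hsupp]
    rintro _ ⟨i, rfl⟩
    change v (x i) = 0
    rcases lt_or_ge (i : ℕ) k with hi | hi
    · have := hxlt i hi
      rw [h0, zero_pow (hω i)] at this
      exact pow_eq_zero_iff (hω 0) |>.mp this
    · exact hxge i hi
  · exact pow_le_one' (hv a) _
  · exact hxlt i hi
  · change v (x i) ^ ω 0 = 0
    rw [hxge i hi, zero_pow (hω 0)]

/-- In a regular local ring with parameters `x`, an element of `(x 0, …, x (r-1)) ^ b` which lies in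
`M ^ (b + 1)` modulo `(x k, …, x (n-1))`, where `r ≤ k`, already lies in `M ^ (b + 1)`. -/
theorem IsLocalRing.mem_maximalIdeal_pow_succ_of_mem_sup {R : Type u} [CommRing R] [IsLocalRing R]
    [IsNoetherianRing R] {n : ℕ} (hdim : ringKrullDim R = n) (x : Fin n → R)
    (hgen : Ideal.span (Set.range x) = maximalIdeal R) {r k : ℕ} (hk : 0 < k) (hrk : r ≤ k)
    (hkn : k ≤ n) {b : ℕ} {f : R}
    (hfP : f ∈ Ideal.span (x '' {i : Fin n | (i : ℕ) < r}) ^ b)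
    (hf : f ∈ maximalIdeal R ^ (b + 1) ⊔ Ideal.span (x '' {i : Fin n | k ≤ (i : ℕ)})) :
    f ∈ maximalIdeal R ^ (b + 1) := by
  by_contra hfM
  let z : Fin r → R := fun i => x (Fin.castLE (hrk.trans hkn) i)
  have hxM : ∀ i, x i ∈ maximalIdeal R := fun i => hgen ▸ Ideal.subset_span ⟨i, rfl⟩
  have hPz : Ideal.span (x '' {i : Fin n | (i : ℕ) < r}) ≤ Ideal.span (Set.range z) := by
    refine Ideal.span_mono ?_
    rintro _ ⟨i, hi, rfl⟩
    exact ⟨⟨i, hi⟩, rfl⟩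
  obtain ⟨F, hF, rfl⟩ := Ideal.exists_isHomogeneous_eval_eq_of_mem_span_range_pow z b
    (Ideal.pow_right_mono hPz b hfP)
  have hcoeff : ∃ m, F.coeff m ∉ maximalIdeal R := by
    by_contra! h
    refine hfM ?_
    rw [MvPolynomial.eval_eq']
    refine Ideal.sum_mem _ fun m hm => ?_
    rw [pow_succ']
    refine Ideal.mul_mem_mul (h m) ?_
    have hd : ∑ i, m i = b := by
      rw [← Finsupp.degree_eq_sum, Finsupp.degree_eq_weight_one]
      exact hF (MvPolynomial.mem_support_iff.mp hm)
    rw [← hd, ← Finset.prod_pow_eq_pow_sum]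
    exact Ideal.prod_mem_prod fun i _ => Ideal.pow_mem_pow (hxM _) _
  let A := b * (b + 2) ^ r + 1
  let ω : ℕ → ℕ := fun i => A + (b + 2) ^ i
  have hsum : ∀ m : Fin r →₀ ℕ, m.degree = b →
      ∑ i, m i * ω i = b * A + ∑ i, m i * (b + 2) ^ (i : ℕ) := by
    intro m hm
    simp only [ω, mul_add, Finset.sum_add_distrib, ← Finset.sum_mul]
    rw [← Finsupp.degree_eq_sum, hm]
  obtain ⟨Γ₀, _, v, g, hg0, hg1, hv, hxlt, hxge⟩ :=
    exists_valuation_eq_pow hdim x hgen k hk hkn ω (fun i => by simp [ω, A])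
  have hvM : ∀ a ∈ maximalIdeal R, v a ≤ g ^ A := by
    intro a ha
    rw [← hgen] at ha
    obtain ⟨c, rfl⟩ := Ideal.mem_span_range_iff_exists_fun.mp ha
    refine v.map_sum_le fun i _ => ?_
    rw [map_mul]
    refine (mul_le_of_le_one_left' (hv _)).trans ?_
    rcases lt_or_ge (i : ℕ) k with hi | hi
    · rw [hxlt i hi]
      exact pow_le_pow_right_of_le_one' hg1.le (Nat.le_add_right _ _)
    · rw [hxge i hi]
      exact zero_le
  have hlarge := v.pow_lt_map_eval_of_isHomogeneous hv hg0 hg1 (A := A) (fun i : Fin r => ω i)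
    (fun i => Nat.le_add_right _ _)
    (fun m hm => by
      rw [hsum m hm]
      have : ∑ i, m i * (b + 2) ^ (i : ℕ) ≤ b * (b + 2) ^ r := by
        rw [← hm, Finsupp.degree_eq_sum, Finset.sum_mul]
        exact Finset.sum_le_sum fun i _ =>
          Nat.mul_le_mul_left _ (Nat.pow_le_pow_right (by omega) i.2.le)
      have hA : A = b * (b + 2) ^ r + 1 := rfl
      linarith)
    (fun m m' hm hm' h => by
      rw [hsum m hm, hsum m' hm'] at h
      exact Finsupp.eq_of_sum_mul_pow_eq (by omega) (by omega) hm hm' (Nat.add_left_cancel h))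
    hvM z (fun i => hxlt _ (i.2.trans_le hrk)) F hF hcoeff
  obtain ⟨c, hc, q, hq, hcq⟩ := Submodule.mem_sup.mp hf
  have hqv : q ∈ v.supp := by
    refine (Ideal.span_le.mpr ?_ : Ideal.span _ ≤ v.supp) hq
    rintro _ ⟨i, hi, rfl⟩
    exact hxge i hi
  rw [← hcq, v.map_add_supp c hqv, pow_mul] at hlarge
  exact hlarge.not_ge (v.map_le_pow_of_mem_pow hv hvM (b + 1) hc)

/-- Let `(R, M)` be a regular local ring of Krull dimension `n` (noetherian local, with
the maximal ideal `M` generated by a regular system of parameters `x 0, …, x (n-1)`).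
Let `1 ≤ r < s ≤ n`, `P = (x 0, …, x (r-1))`, `Q = (x (s-1), …, x (n-1))`, and let
`R̄ = R ⧸ Q` with maximal ideal `M̄ = M·R̄`. If `b ≥ 1` and `I` is an ideal of `R` with
`I ⊆ P ^ b` and `I ⊄ M ^ (b+1)`, then the image ideal `Ī = I·R̄` satisfies `Ī ⊆ M̄ ^ b`
and `Ī ⊄ M̄ ^ (b+1)`; i.e. the order of `Ī` in `R̄` is exactly `b`. -/
theorem order_of_image_ideal_eq
    {R : Type*} [CommRing R] [IsLocalRing R] [IsNoetherianRing R]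
    (n : ℕ) (hdim : ringKrullDim R = n) (x : Fin n → R)
    (hgen : Ideal.span (Set.range x) = maximalIdeal R)
    (r s : ℕ) (hr : 1 ≤ r) (hrs : r < s) (hsn : s ≤ n)
    (P Q : Ideal R)
    (hP : P = Ideal.span (x '' {i : Fin n | (i : ℕ) < r}))
    (hQ : Q = Ideal.span (x '' {i : Fin n | s ≤ (i : ℕ) + 1}))
    (b : ℕ) (hb : 1 ≤ b) (I : Ideal R)
    (hIP : I ≤ P ^ b) (hIM : ¬ I ≤ (maximalIdeal R) ^ (b + 1)) :
    I.map (Ideal.Quotient.mk Q) ≤ ((maximalIdeal R).map (Ideal.Quotient.mk Q)) ^ b ∧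
      ¬ I.map (Ideal.Quotient.mk Q) ≤
        ((maximalIdeal R).map (Ideal.Quotient.mk Q)) ^ (b + 1) := by
  subst hP hQ
  have hPM : Ideal.span (x '' {i : Fin n | (i : ℕ) < r}) ≤ maximalIdeal R :=
    hgen ▸ Ideal.span_mono (Set.image_subset_range _ _)
  rw [← Ideal.map_pow, ← Ideal.map_pow]
  refine ⟨Ideal.map_mono (hIP.trans (Ideal.pow_right_mono hPM b)), fun h => hIM fun f hf => ?_⟩
  have hset : {i : Fin n | s ≤ (i : ℕ) + 1} = {i : Fin n | s - 1 ≤ (i : ℕ)} := by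
    ext i
    simp
  refine mem_maximalIdeal_pow_succ_of_mem_sup hdim x hgen (k := s - 1) (by omega) (by omega)
    (by omega) (hIP hf) ?_
  rw [← hset]
  have := Ideal.map_le_iff_le_comap.mp h hf
  rwa [Ideal.comap_map_of_surjective' _ Ideal.Quotient.mk_surjective, Ideal.mk_ker] at this
end

section
/- Let k be a field of characteristic zero, let R = k[X_1,…,X_n] be the polynomial ring, let J be a nonzero ideal of R, let b ≥ 1 be an integer, and let P be a prime ideal of R. Then the extension J·R_P of J to the localization R_P is contained in (P·R_P)^b (i.e. the order of J in the regular local ring R_P is at least b) if and only if Δ^{b-1}(J) ⊆ P. -/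
/-- `Δ(J)`: the ideal generated by the elements of `J` together with all partial
derivatives of elements of `J`. -/
noncomputable def deltaIdeal {k : Type*} [CommRing k] {σ : Type*}
    (J : Ideal (MvPolynomial σ k)) : Ideal (MvPolynomial σ k) :=
  J ⊔ Ideal.span {g | ∃ f ∈ J, ∃ i : σ, g = MvPolynomial.pderiv i f}

open MvPolynomial IsLocalRing

/-- If the residue field of a local `k`-algebra `A` is formally smooth over `k`, there is a
derivation `A → A ⧸ 𝔪 ^ 2` with values in `𝔪 ⧸ 𝔪 ^ 2` which restricts to the quotient map
on `𝔪`. -/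
lemma exists_derivation_eq_mk_on_maximalIdeal (k A : Type*) [Field k] [CommRing A] [IsLocalRing A]
    [Algebra k A] [Algebra.FormallySmooth k (ResidueField A)] :
    ∃ D : Derivation k A (A ⧸ maximalIdeal A ^ 2),
      (∀ a ∈ maximalIdeal A, D a = Ideal.Quotient.mk _ a) ∧
      ∀ a, ∃ y ∈ maximalIdeal A, Ideal.Quotient.mk _ y = D a := by
  let g : A ⧸ maximalIdeal A ^ 2 →ₐ[k] ResidueField A :=
    Ideal.Quotient.liftₐ _ (IsScalarTower.toAlgHom k A (ResidueField A)) fun a ha ↦ by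
      simpa using (Ideal.pow_le_self two_ne_zero ha)
  have hg_mk (a : A) : g (Ideal.Quotient.mk _ a) = residue A a := rfl
  have hg : Function.Surjective g := fun x ↦ by
    obtain ⟨a, rfl⟩ := residue_surjective x
    exact ⟨Ideal.Quotient.mk _ a, rfl⟩
  have ker_lift {x} (hx : g x = 0) : ∃ y ∈ maximalIdeal A, Ideal.Quotient.mk _ y = x := by
    obtain ⟨y, rfl⟩ := Ideal.Quotient.mk_surjective x
    exact ⟨y, (residue_eq_zero_iff y).1 hx, rfl⟩
  have ker_mul {x y} (hx : g x = 0) (hy : g y = 0) : x * y = 0 := by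
    obtain ⟨a, ha, rfl⟩ := ker_lift hx
    obtain ⟨b, hb, rfl⟩ := ker_lift hy
    rw [← map_mul, Ideal.Quotient.eq_zero_iff_mem, pow_two]
    exact Ideal.mul_mem_mul ha hb
  have hker : IsNilpotent (RingHom.ker (g : A ⧸ maximalIdeal A ^ 2 →+* ResidueField A)) := by
    refine ⟨2, (pow_two _).trans (eq_bot_iff.2 (Ideal.mul_le.2 ?_))⟩
    exact fun x hx y hy ↦ ker_mul hx hy
  let s := Algebra.FormallySmooth.liftOfSurjective (AlgHom.id k (ResidueField A)) g hg hker
  have hs (x) : g (s x) = x :=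
    Algebra.FormallySmooth.liftOfSurjective_apply (AlgHom.id k (ResidueField A)) g hg hker x
  let L : A →ₗ[k] A ⧸ maximalIdeal A ^ 2 :=
    (Ideal.Quotient.mkₐ k (maximalIdeal A ^ 2)).toLinearMap -
      (s.comp (IsScalarTower.toAlgHom k A (ResidueField A))).toLinearMap
  have hL (a) : L a = Ideal.Quotient.mk _ a - s (residue A a) := rfl
  have hgL (a) : g (L a) = 0 := by rw [hL, map_sub, hs, hg_mk, sub_self]
  refine ⟨Derivation.mk' L fun a b ↦ ?_, fun a ha ↦ ?_, fun a ↦ ker_lift (hgL a)⟩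
  · have h := ker_mul (hgL a) (hgL b)
    simp only [hL, map_mul, Algebra.smul_def, Ideal.Quotient.algebraMap_eq] at h ⊢
    linear_combination -h
  · rw [Derivation.coe_mk', hL, (residue_eq_zero_iff a).2 ha, map_zero, sub_zero]

lemma mkDerivation_apply_eq_sum_pderiv {k σ M : Type*} [CommRing k] [Fintype σ] [AddCommGroup M]
    [Module k M] [Module (MvPolynomial σ k) M] [IsScalarTower k (MvPolynomial σ k) M]
    (y : σ → M) (f : MvPolynomial σ k) :
    mkDerivation k y f = ∑ i, pderiv i f • y i := by
  classical
  let D : Derivation k (MvPolynomial σ k) M :=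
    ∑ i, (LinearMap.toSpanSingleton (MvPolynomial σ k) M (y i)).compDer (pderiv i)
  have hD (f) : D f = ∑ i, pderiv i f • y i := by
    have h := map_sum (Derivation.coeFnAddMonoidHom (R := k) (A := MvPolynomial σ k) (M := M))
      (fun i ↦ (LinearMap.toSpanSingleton (MvPolynomial σ k) M (y i)).compDer (pderiv i)) .univ
    exact (congr_fun h f).trans (by simp)
  rw [← hD]
  congr 1
  refine derivation_ext fun j ↦ ?_
  simp [hD, pderiv_X, Pi.single_apply]

section

variable {k : Type*} [Field k] {σ : Type*} {P : Ideal (MvPolynomial σ k)} [P.IsPrime]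

local notation "A" => Localization.AtPrime P
local notation "𝔪" => Ideal.map (algebraMap (MvPolynomial σ k) A) P

/-- At a prime of a polynomial ring over a field of characteristic zero there is an Euler
derivation, i.e. a combination of the partial derivatives with coefficients in the maximal ideal
which is the identity on the cotangent space. -/
lemma exists_euler_derivation [CharZero k] [Finite σ] :
    ∃ y : σ → A, (∀ i, y i ∈ 𝔪) ∧
      ∀ p ∈ P, mkDerivation k y p - algebraMap _ A p ∈ 𝔪 ^ 2 := by
  have : Algebra.EssFiniteType k A := .comp k (MvPolynomial σ k) A
  have : Algebra.EssFiniteType k (ResidueField A) := .comp k A (ResidueField A)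
  obtain ⟨D, hD, hD'⟩ := exists_derivation_eq_mk_on_maximalIdeal k A
  choose y hy hyD using fun i : σ ↦ hD' (algebraMap (MvPolynomial σ k) A (X i))
  rw [Localization.AtPrime.map_eq_maximalIdeal]
  refine ⟨y, hy, fun p hp ↦ ?_⟩
  have h : (((maximalIdeal A ^ 2).mkQ).restrictScalars (MvPolynomial σ k)).compDer
      (mkDerivation k y) = D.compAlgebraMap (MvPolynomial σ k) := by
    refine derivation_ext fun i ↦ ?_
    simpa using hyD i
  have hp' : algebraMap _ A p ∈ maximalIdeal A := by
    rw [← Localization.AtPrime.map_eq_maximalIdeal]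
    exact Ideal.mem_map_of_mem _ hp
  rw [← Ideal.Quotient.mk_eq_mk_iff_sub_mem, ← hD _ hp']
  exact DFunLike.congr_fun h p

lemma derivation_sub_mul_mem_pow_succ (E : Derivation k (MvPolynomial σ k) A)
    (hE : ∀ p ∈ P, E p - algebraMap _ A p ∈ 𝔪 ^ 2) (m : ℕ) {g : MvPolynomial σ k}
    (hg : g ∈ P ^ (m + 1)) :
    E g - (m + 1) * algebraMap _ A g ∈ 𝔪 ^ (m + 2) := by
  induction m generalizing g with
  | zero => simpa using hE g (by simpa using hg)
  | succ m ih =>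
    rw [pow_succ'] at hg
    refine Submodule.mul_induction_on hg (fun p hp q hq ↦ ?_) fun x y hx hy ↦ ?_
    · have h₁ : algebraMap _ A p * (E q - (m + 1) * algebraMap _ A q) ∈ 𝔪 ^ (m + 1 + 2) := by
        rw [show m + 1 + 2 = (m + 2) + 1 by ring, pow_succ']
        exact Ideal.mul_mem_mul (Ideal.mem_map_of_mem _ hp) (ih hq)
      have h₂ : algebraMap _ A q * (E p - algebraMap _ A p) ∈ 𝔪 ^ (m + 1 + 2) := by
        rw [pow_add]
        refine Ideal.mul_mem_mul ?_ (hE p hp)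
        rw [← Ideal.map_pow]
        exact Ideal.mem_map_of_mem _ hq
      convert add_mem h₁ h₂ using 1
      simp only [Derivation.leibniz, Algebra.smul_def, map_mul]
      push_cast
      ring
    · convert add_mem hx hy using 1
      simp only [map_add]
      ring

lemma algebraMap_mem_pow_iff_exists_mul_mem (m : ℕ) (f : MvPolynomial σ k) :
    algebraMap _ A f ∈ 𝔪 ^ m ↔ ∃ s ∉ P, s * f ∈ P ^ m := by
  rw [← Ideal.map_pow, IsLocalization.algebraMap_mem_map_algebraMap_iff P.primeCompl]
  rfl

lemma algebraMap_pderiv_mem_pow {m : ℕ} {f : MvPolynomial σ k}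
    (hf : algebraMap _ A f ∈ 𝔪 ^ (m + 1)) (i : σ) : algebraMap _ A (pderiv i f) ∈ 𝔪 ^ m := by
  rw [algebraMap_mem_pow_iff_exists_mul_mem] at hf ⊢
  obtain ⟨s, hs, hsf⟩ := hf
  have h (m : ℕ) {g : MvPolynomial σ k} (hg : g ∈ P ^ (m + 1)) : pderiv i g ∈ P ^ m := by
    induction m generalizing g with
    | zero => simp
    | succ m ih =>
      rw [pow_succ'] at hg
      refine Submodule.mul_induction_on hg (fun p hp q hq ↦ ?_) fun x y hx hy ↦ ?_
      · rw [Derivation.leibniz, smul_eq_mul, smul_eq_mul]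
        refine add_mem ?_ (Ideal.mul_mem_right _ _ hq)
        rw [pow_succ']
        exact Ideal.mul_mem_mul hp (ih hq)
      · rw [map_add]
        exact add_mem hx hy
  refine ⟨s * s, fun hss ↦ hs ((Ideal.IsPrime.mem_or_mem ‹_› hss).elim id id), ?_⟩
  have h₁ : s * pderiv i (s * f) ∈ P ^ m := Ideal.mul_mem_left _ _ (h m hsf)
  have h₂ : pderiv i s * (s * f) ∈ P ^ m :=
    Ideal.mul_mem_left _ _ (Ideal.pow_le_pow_right m.le_succ hsf)
  convert sub_mem h₁ h₂ using 1
  rw [Derivation.leibniz, smul_eq_mul, smul_eq_mul]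
  ring

lemma algebraMap_mem_pow_succ_of_pderiv_mem [CharZero k] [Finite σ] {m : ℕ}
    {f : MvPolynomial σ k} (hf : algebraMap _ A f ∈ 𝔪 ^ (m + 1))
    (hf' : ∀ i, algebraMap _ A (pderiv i f) ∈ 𝔪 ^ (m + 1)) :
    algebraMap _ A f ∈ 𝔪 ^ (m + 2) := by
  cases nonempty_fintype σ
  obtain ⟨y, hy, hE⟩ := exists_euler_derivation (P := P)
  obtain ⟨s, hs, hsf⟩ := (algebraMap_mem_pow_iff_exists_mul_mem _ _).1 hf
  have h₁ := derivation_sub_mul_mem_pow_succ _ hE m hsf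
  have h₂ : mkDerivation k y (s * f) ∈ 𝔪 ^ (m + 2) := by
    rw [mkDerivation_apply_eq_sum_pderiv]
    refine sum_mem fun i _ ↦ ?_
    rw [Algebra.smul_def, pow_succ]
    refine Ideal.mul_mem_mul ?_ (hy i)
    rw [Derivation.leibniz, smul_eq_mul, smul_eq_mul, map_add, map_mul, map_mul]
    exact add_mem (Ideal.mul_mem_left _ _ (hf' i)) (Ideal.mul_mem_right _ _ hf)
  have h₃ := sub_mem h₂ h₁
  rw [sub_sub_cancel, map_mul, ← mul_assoc] at h₃
  refine (Ideal.unit_mul_mem_iff_mem _ (IsUnit.mul ?_ ?_)).1 h₃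
  · have := (IsUnit.mk0 ((m : k) + 1) (by exact_mod_cast m.succ_ne_zero)).map (algebraMap k A)
    simpa using this
  · exact IsLocalization.map_units A (⟨s, hs⟩ : P.primeCompl)

lemma deltaIdeal_le_comap_pow_iff [CharZero k] [Finite σ] (J : Ideal (MvPolynomial σ k)) (m : ℕ) :
    deltaIdeal J ≤ (𝔪 ^ (m + 1)).comap (algebraMap _ A) ↔
      J ≤ (𝔪 ^ (m + 2)).comap (algebraMap _ A) := by
  rw [deltaIdeal, sup_le_iff, Ideal.span_le]
  constructor
  · rintro ⟨h₁, h₂⟩ f hf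
    exact algebraMap_mem_pow_succ_of_pderiv_mem (h₁ hf) fun i ↦ h₂ ⟨f, hf, i, rfl⟩
  · intro h
    refine ⟨fun f hf ↦ Ideal.pow_le_pow_right (m + 1).le_succ (h hf), ?_⟩
    rintro _ ⟨f, hf, i, rfl⟩
    exact algebraMap_pderiv_mem_pow (h hf) i

lemma le_comap_pow_succ_iff_iterate_deltaIdeal_le [CharZero k] [Finite σ]
    (J : Ideal (MvPolynomial σ k)) (m : ℕ) :
    J ≤ (𝔪 ^ (m + 1)).comap (algebraMap _ A) ↔ deltaIdeal^[m] J ≤ P := by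
  induction m generalizing J with
  | zero =>
    rw [zero_add, pow_one, Localization.AtPrime.map_eq_maximalIdeal, ← Ideal.under_def,
      Localization.AtPrime.under_maximalIdeal, Function.iterate_zero_apply]
  | succ m ih => rw [Function.iterate_succ_apply, ← ih, deltaIdeal_le_comap_pow_iff]

end

/-- Let `k` be a field of characteristic zero, `R = k[X_1, …, X_n]`, `J` a nonzero ideal
of `R`, `b ≥ 1`, and `P` a prime ideal of `R`. Then the order of `J` in `R_P` is at
least `b` (i.e. `J·R_P ⊆ (P·R_P) ^ b`) if and only if `Δ^(b-1)(J) ⊆ P`. -/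
theorem order_ge_iff_delta_le_prime
    {k : Type*} [Field k] [CharZero k] (n : ℕ)
    (J : Ideal (MvPolynomial (Fin n) k)) (hJ : J ≠ ⊥) (b : ℕ) (hb : 1 ≤ b)
    (P : Ideal (MvPolynomial (Fin n) k)) (hP : P.IsPrime) :
    haveI := hP
    J.map (algebraMap (MvPolynomial (Fin n) k) (Localization.AtPrime P)) ≤
        (P.map (algebraMap (MvPolynomial (Fin n) k) (Localization.AtPrime P))) ^ b ↔
      deltaIdeal^[b - 1] J ≤ P := by
  obtain ⟨m, rfl⟩ := Nat.exists_eq_add_of_le' hb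
  rw [Ideal.map_le_iff_le_comap, Nat.add_sub_cancel]
  exact le_comap_pow_succ_iff_iterate_deltaIdeal_le J m
end

section
/- Let k be a field of characteristic zero, R = k[X_1,…,X_n] the polynomial ring, S a subset of {1,…,n}, and P the prime ideal of R generated by the variables {X_i : i ∈ S}. Then for every ideal J of R and every integer b ≥ 1, one has J ⊆ P^b if and only if Δ^{b-1}(J) ⊆ P. -/
open MvPolynomial

/-- The number of variables from `S`, counted with multiplicity, in the monomial with
exponent `m`. -/
noncomputable def degreeIn {σ : Type*} (S : Set σ) : (σ →₀ ℕ) →+ ℕ :=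
  Finsupp.weight (S.indicator 1)

section

variable {σ k : Type*} {S : Set σ}

theorem degreeIn_single_of_mem {i : σ} (hi : i ∈ S) : degreeIn S (Finsupp.single i 1) = 1 := by
  simp [degreeIn, Finsupp.weight_single, hi]

theorem degreeIn_single_le (i : σ) : degreeIn S (Finsupp.single i 1) ≤ 1 := by
  by_cases hi : i ∈ S <;> simp [degreeIn, Finsupp.weight_single, hi]

theorem exists_eq_add_single_of_degreeIn_pos {m : σ →₀ ℕ} (hm : 0 < degreeIn S m) :
    ∃ i ∈ S, ∃ m' : σ →₀ ℕ, m = m' + Finsupp.single i 1 := by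
  obtain ⟨i, hi, hmi⟩ : ∃ i ∈ S, m i ≠ 0 := by
    by_contra! h
    refine hm.ne' ?_
    rw [degreeIn, Finsupp.weight_apply]
    refine Finset.sum_eq_zero fun i _ => ?_
    by_cases hi : i ∈ S <;> simp [hi, h]
  refine ⟨i, hi, m - Finsupp.single i 1, (tsub_add_cancel_of_le ?_).symm⟩
  simpa [Nat.one_le_iff_ne_zero] using hmi

theorem monomial_mem_pow_span_X_image [CommSemiring k] {b : ℕ} {m : σ →₀ ℕ}
    (hm : b ≤ degreeIn S m) (a : k) :
    monomial m a ∈ Ideal.span (X '' S : Set (MvPolynomial σ k)) ^ b := by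
  induction b generalizing m with
  | zero => simp
  | succ b ih =>
    obtain ⟨i, hi, m', rfl⟩ := exists_eq_add_single_of_degreeIn_pos (b.succ_pos.trans_le hm)
    rw [map_add, degreeIn_single_of_mem hi] at hm
    have key : monomial (m' + Finsupp.single i 1) a = monomial m' a * X i := by
      simp [X, monomial_mul]
    rw [key, pow_succ]
    exact Ideal.mul_mem_mul (ih (by lia)) (Ideal.subset_span ⟨i, hi, rfl⟩)

theorem mem_pow_span_X_image_iff [CommSemiring k] {b : ℕ} {f : MvPolynomial σ k} :
    f ∈ Ideal.span (X '' S : Set (MvPolynomial σ k)) ^ b ↔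
      ∀ m ∈ f.support, b ≤ degreeIn S m := by
  classical
  refine ⟨fun hf => ?_, fun h => ?_⟩
  · induction b generalizing f with
    | zero => simp
    | succ b ih =>
      rw [pow_succ] at hf
      refine Submodule.mul_induction_on hf (fun g hg x hx m hm => ?_) fun g h hg hh m hm => ?_
      · obtain ⟨u, hu, v, hv, rfl⟩ := Finset.mem_add.mp (support_mul g x hm)
        obtain ⟨i, hi, hvi⟩ := mem_ideal_span_X_image.mp hx v hv
        obtain ⟨w, rfl⟩ := le_iff_exists_add'.mp
          (show Finsupp.single i 1 ≤ v by simpa [Nat.one_le_iff_ne_zero] using hvi)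
        have := ih hg u hu
        rw [map_add, map_add, degreeIn_single_of_mem hi]
        lia
      · rcases Finset.mem_union.mp (support_add hm) with h' | h'
        exacts [hg m h', hh m h']
  · rw [f.as_sum]
    exact Ideal.sum_mem _ fun m hm => monomial_mem_pow_span_X_image (h m hm) _

theorem pderiv_mem_pow_span_X_image [CommSemiring k] {c : ℕ} {f : MvPolynomial σ k}
    (hf : f ∈ Ideal.span (X '' S : Set (MvPolynomial σ k)) ^ (c + 1)) (i : σ) :
    pderiv i f ∈ Ideal.span (X '' S : Set (MvPolynomial σ k)) ^ c := by
  rw [mem_pow_span_X_image_iff] at hf ⊢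
  intro m hm
  rw [mem_support_iff, coeff_pderiv] at hm
  have h := hf _ (mem_support_iff.mpr (left_ne_zero_of_mul hm))
  rw [map_add] at h
  have := degreeIn_single_le (S := S) i
  lia

theorem mem_pow_succ_span_X_image_of_pderiv_mem [CommSemiring k] [NoZeroDivisors k] [CharZero k]
    {c : ℕ} (hc : 1 ≤ c) {f : MvPolynomial σ k}
    (hf : f ∈ Ideal.span (X '' S : Set (MvPolynomial σ k)) ^ c)
    (hd : ∀ i, pderiv i f ∈ Ideal.span (X '' S : Set (MvPolynomial σ k)) ^ c) :
    f ∈ Ideal.span (X '' S : Set (MvPolynomial σ k)) ^ (c + 1) := by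
  simp only [mem_pow_span_X_image_iff] at hf hd ⊢
  intro m hm
  obtain ⟨i, hi, m', rfl⟩ := exists_eq_add_single_of_degreeIn_pos (hc.trans (hf m hm))
  have h := hd i m' <| by
    rw [mem_support_iff, coeff_pderiv]
    exact mul_ne_zero (mem_support_iff.mp hm) (Nat.cast_add_one_ne_zero _)
  rw [map_add, degreeIn_single_of_mem hi]
  lia

theorem deltaIdeal_le_iff [CommRing k] {J I : Ideal (MvPolynomial σ k)} :
    deltaIdeal J ≤ I ↔ J ≤ I ∧ ∀ f ∈ J, ∀ i, pderiv i f ∈ I := by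
  rw [deltaIdeal, sup_le_iff, Ideal.span_le]
  refine and_congr_right fun _ => ⟨fun h f hf i => h ⟨f, hf, i, rfl⟩, ?_⟩
  rintro h _ ⟨f, hf, i, rfl⟩
  exact h f hf i

theorem le_pow_succ_iff_deltaIdeal_le_pow [CommRing k] [NoZeroDivisors k] [CharZero k]
    {c : ℕ} (hc : 1 ≤ c) {J : Ideal (MvPolynomial σ k)} :
    J ≤ Ideal.span (X '' S : Set (MvPolynomial σ k)) ^ (c + 1) ↔
      deltaIdeal J ≤ Ideal.span (X '' S : Set (MvPolynomial σ k)) ^ c := by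
  rw [deltaIdeal_le_iff]
  exact ⟨fun h => ⟨h.trans (Ideal.pow_le_pow_right c.le_succ),
      fun f hf i => pderiv_mem_pow_span_X_image (h hf) i⟩,
    fun h f hf => mem_pow_succ_span_X_image_of_pderiv_mem hc (h.1 hf) (h.2 f hf)⟩

end

/-- Let `k` be a field of characteristic zero, `R = k[X_1, …, X_n]`, `S` a subset of the
variables, and `P` the (prime) ideal generated by the variables `X i`, `i ∈ S`. Then for
every ideal `J` of `R` and every `b ≥ 1`: `J ⊆ P ^ b` iff `Δ^(b-1)(J) ⊆ P`. -/
theorem le_pow_regular_prime_iff_delta_le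
    {k : Type*} [Field k] [CharZero k] (n : ℕ) (S : Set (Fin n))
    (P : Ideal (MvPolynomial (Fin n) k))
    (hP : P = Ideal.span (MvPolynomial.X '' S))
    (J : Ideal (MvPolynomial (Fin n) k)) (b : ℕ) (hb : 1 ≤ b) :
    J ≤ P ^ b ↔ deltaIdeal^[b - 1] J ≤ P := by
  subst hP
  induction b, hb using Nat.le_induction generalizing J with
  | base => simp
  | succ c hc ih =>
    obtain ⟨d, rfl⟩ := Nat.exists_eq_add_of_le' hc
    rw [le_pow_succ_iff_deltaIdeal_le_pow hc, ih]
    rfl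
end

section
/- Let R be a noetherian local ring and P a prime ideal of R with dim(R/P) ≥ 1. Then for every element f ∈ R with f ∉ P there exists a prime ideal Q of R with P ⊆ Q, f ∉ Q, and dim(R/Q) = 1. Consequently, P is the intersection of all prime ideals Q of R containing P with dim(R/Q) = 1. -/
open IsLocalRing in
/-- A noetherian local domain with a nonzero nonunit `f` lying in every nonzero prime ideal
has Krull dimension one. -/
theorem ringKrullDim_eq_one_of_forall_prime_mem
    {A : Type*} [CommRing A] [IsDomain A] [IsNoetherianRing A] [IsLocalRing A]
    {f : A} (hf0 : f ≠ 0) (hfm : f ∈ maximalIdeal A)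
    (hf : ∀ q : Ideal A, q.IsPrime → q ≠ ⊥ → f ∈ q) : ringKrullDim A = 1 := by
  have one_le_height {I : Ideal A} (hI : I ≠ ⊥) : 1 ≤ I.height :=
    Order.one_le_iff_ne_zero.mpr (Ideal.height_eq_zero_iff_eq_bot.not.mpr hI)
  have hspan : 1 ≤ (Ideal.span {f}).height :=
    one_le_height (by simpa [Ideal.span_singleton_eq_bot] using hf0)
  have hmem {x : A} (hx0 : x ≠ 0) (hx : x ∈ maximalIdeal A) :
      ∃ q ∈ (Ideal.span {f}).minimalPrimes, x ∈ q := by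
    obtain ⟨q, hq, -⟩ := Ideal.exists_minimalPrimes_le
      ((Ideal.span_singleton_le_iff_mem (maximalIdeal A)).mpr hx)
    have := hq.isPrime
    have hxq : x ∈ q := hq.1.2 (Ideal.mem_span_singleton_self x)
    have hfq : f ∈ q := hf q this fun h ↦ hx0 (by simpa [h] using hxq)
    exact ⟨q, Ideal.mem_minimalPrimes_of_height_le
      ((Ideal.span_singleton_le_iff_mem q).mpr hfq)
      ((Ideal.height_le_one_of_isPrincipal_of_mem_minimalPrimes _ q hq).trans hspan), hxq⟩
  obtain ⟨q, hq, hle⟩ := (Ideal.subset_union_prime_finite (f := id)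
    (Ideal.finite_minimalPrimes_of_isNoetherianRing A (Ideal.span {f})) ⊥ ⊥
    (fun _ h _ _ ↦ h.isPrime) (I := maximalIdeal A)).mp fun x hx ↦ by
      obtain rfl | hx0 := eq_or_ne x 0
      · obtain ⟨q, hq, -⟩ := hmem hf0 hfm
        exact Set.mem_biUnion hq q.zero_mem
      · obtain ⟨q, hq, hxq⟩ := hmem hx0 hx
        exact Set.mem_biUnion hq hxq
  have hle1 : (maximalIdeal A).height ≤ 1 := (Ideal.height_mono hle).trans
    (Ideal.height_le_one_of_isPrincipal_of_mem_minimalPrimes _ q hq)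
  have hge1 : 1 ≤ (maximalIdeal A).height :=
    one_le_height fun h ↦ hf0 (by simpa [h] using hfm)
  rw [← maximalIdeal_height_eq_ringKrullDim, le_antisymm hle1 hge1]
  rfl

open IsLocalRing in
/-- In a noetherian local ring, a prime `P ≠ 𝔪` and an element `f ∉ P` admit a prime `Q ⊇ P`
with `f ∉ Q` and `dim (R ⧸ Q) = 1`. -/
theorem exists_prime_ge_notMem_ringKrullDim_quotient_eq_one
    {R : Type*} [CommRing R] [IsNoetherianRing R] [IsLocalRing R]
    {P : Ideal R} (hP : P.IsPrime) (hPm : P ≠ maximalIdeal R) {f : R} (hf : f ∉ P) :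
    ∃ Q : Ideal R, Q.IsPrime ∧ P ≤ Q ∧ f ∉ Q ∧ ringKrullDim (R ⧸ Q) = 1 := by
  obtain ⟨g, hgm, hgP⟩ := SetLike.exists_of_lt (lt_of_le_of_ne (le_maximalIdeal hP.ne_top) hPm)
  have hfg : f * g ∉ P := fun h ↦ (hP.mem_or_mem h).elim hf hgP
  obtain ⟨Q, ⟨hQ, hPQ, hfgQ⟩, hmax⟩ := set_has_maximal_iff_noetherian.mpr
    (inferInstanceAs (IsNoetherian R R))
    {Q : Ideal R | Q.IsPrime ∧ P ≤ Q ∧ f * g ∉ Q} ⟨P, hP, le_rfl, hfg⟩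
  refine ⟨Q, hQ, hPQ, fun h ↦ hfgQ (Ideal.mul_mem_right g Q h), ?_⟩
  have hloc : IsLocalRing (R ⧸ Q) :=
    .of_surjective' (Ideal.Quotient.mk Q) Ideal.Quotient.mk_surjective
  refine ringKrullDim_eq_one_of_forall_prime_mem (f := Ideal.Quotient.mk Q (f * g)) ?_ ?_ ?_
  · rwa [Ne, Ideal.Quotient.eq_zero_iff_mem]
  · have := IsLocalHom.of_surjective (Ideal.Quotient.mk Q) Ideal.Quotient.mk_surjective
    rw [mem_maximalIdeal, mem_nonunits_iff, isUnit_map_iff]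
    exact (maximalIdeal R).mul_mem_left f hgm
  · intro q hq hq0
    by_contra hfq
    have hle : Q ≤ q.comap (Ideal.Quotient.mk Q) := fun x hx ↦ by
      simp [Ideal.mem_comap, Ideal.Quotient.eq_zero_iff_mem.mpr hx]
    refine hmax (q.comap (Ideal.Quotient.mk Q)) ⟨hq.comap _, hPQ.trans hle, hfq⟩
      (lt_of_le_of_ne hle fun h ↦ hq0 ?_)
    rw [← Ideal.map_comap_of_surjective _ Ideal.Quotient.mk_surjective q, ← h,
      Ideal.map_quotient_self]

/-- Let `R` be a noetherian local ring and `P` a prime ideal with `dim (R ⧸ P) ≥ 1`.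
Then for every `f ∉ P` there is a prime `Q ⊇ P` with `f ∉ Q` and `dim (R ⧸ Q) = 1`;
consequently `P` is the intersection of all primes `Q ⊇ P` with `dim (R ⧸ Q) = 1`. -/
theorem prime_eq_sInf_coheight_one_primes
    {R : Type*} [CommRing R] [IsNoetherianRing R] [IsLocalRing R]
    (P : Ideal R) (hP : P.IsPrime) (hdim : 1 ≤ ringKrullDim (R ⧸ P)) :
    (∀ f : R, f ∉ P → ∃ Q : Ideal R, Q.IsPrime ∧ P ≤ Q ∧ f ∉ Q ∧
        ringKrullDim (R ⧸ Q) = 1) ∧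
      P = sInf {Q : Ideal R | Q.IsPrime ∧ P ≤ Q ∧ ringKrullDim (R ⧸ Q) = 1} := by
  have hPm : P ≠ IsLocalRing.maximalIdeal R := by
    rintro rfl
    let := Ideal.Quotient.field (IsLocalRing.maximalIdeal R)
    rw [ringKrullDim_eq_zero_of_field] at hdim
    exact absurd hdim (by decide)
  have key (f : R) (hf : f ∉ P) :=
    exists_prime_ge_notMem_ringKrullDim_quotient_eq_one hP hPm hf
  refine ⟨key, le_antisymm (le_sInf fun Q hQ ↦ hQ.2.1) fun f hf ↦ ?_⟩
  by_contra hfP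
  obtain ⟨Q, hQ, hPQ, hfQ, hd⟩ := key f hfP
  exact hfQ ((Submodule.mem_sInf.mp hf) Q ⟨hQ, hPQ, hd⟩)
end

section
/- Let k be a field of characteristic zero, let m ≤ n be positive integers, and let φ : k[X_1,…,X_n] → k[X_1,…,X_m] be the k-algebra homomorphism with φ(X_i) = X_i for 1 ≤ i ≤ m and φ(X_i) = 0 for m < i ≤ n. Then for every ideal J of k[X_1,…,X_n] and every integer c ≥ 0, one has Δ^c(φ(J)·k[X_1,…,X_m]) ⊆ φ(Δ^c(J))·k[X_1,…,X_m]; that is, the Δ-operator applied c times to the image ideal of J under φ is contained in the image ideal under φ of Δ^c(J). -/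
/-- The `k`-algebra homomorphism `k[X_1, …, X_n] → k[X_1, …, X_m]` sending `X i ↦ X i`
for `i < m` and `X i ↦ 0` for `m ≤ i < n`. -/
noncomputable def projHom (k : Type*) [CommRing k] (m n : ℕ) :
    MvPolynomial (Fin n) k →ₐ[k] MvPolynomial (Fin m) k :=
  MvPolynomial.aeval fun i : Fin n =>
    if h : (i : ℕ) < m then MvPolynomial.X ⟨(i : ℕ), h⟩ else 0

/-- Partial derivatives in the surviving variables commute with `projHom`. -/
theorem pderiv_projHom {k : Type*} [CommRing k] {m n : ℕ} (hmn : m ≤ n) (i : Fin m)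
    (f : MvPolynomial (Fin n) k) :
    MvPolynomial.pderiv i (projHom k m n f) =
      projHom k m n (MvPolynomial.pderiv (Fin.castLE hmn i) f) := by
  induction f using MvPolynomial.induction_on with
  | C a => simp [projHom]
  | add p q hp hq => simp only [map_add, hp, hq]
  | mul_X p j hp =>
    have hX : MvPolynomial.pderiv i (projHom k m n (MvPolynomial.X j)) =
        projHom k m n (MvPolynomial.pderiv (Fin.castLE hmn i) (MvPolynomial.X j)) := by
      simp only [projHom, MvPolynomial.aeval_X, MvPolynomial.pderiv_X, Pi.single_apply]
      split_ifs <;> simp_all [Fin.ext_iff, MvPolynomial.pderiv_X]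
    simp only [map_mul, map_add, Derivation.leibniz, smul_eq_mul, hp, hX]

theorem projHom_surjective (k : Type*) [CommRing k] {m n : ℕ} (hmn : m ≤ n) :
    Function.Surjective (projHom k m n) := by
  intro g
  refine ⟨MvPolynomial.rename (Fin.castLE hmn) g, ?_⟩
  rw [projHom, MvPolynomial.aeval_rename]
  simp [Function.comp_def]

theorem deltaIdeal_mono {k : Type*} [CommRing k] {σ : Type*} :
    Monotone (deltaIdeal (k := k) (σ := σ)) := fun _ _ h =>
  sup_le_sup h (Ideal.span_mono fun _ ⟨f, hf, i, hg⟩ => ⟨f, h hf, i, hg⟩)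

theorem deltaIdeal_map_projHom_le {k : Type*} [CommRing k] {m n : ℕ} (hmn : m ≤ n)
    (J : Ideal (MvPolynomial (Fin n) k)) :
    deltaIdeal (J.map (projHom k m n)) ≤ (deltaIdeal J).map (projHom k m n) := by
  refine sup_le (Ideal.map_mono le_sup_left) (Ideal.span_le.2 ?_)
  rintro _ ⟨f, hf, i, rfl⟩
  obtain ⟨g, hg, rfl⟩ :=
    (Ideal.mem_map_iff_of_surjective _ (projHom_surjective k hmn)).1 hf
  rw [pderiv_projHom hmn]
  exact Ideal.mem_map_of_mem _ (Ideal.mem_sup_right (Ideal.subset_span ⟨g, hg, _, rfl⟩))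

/-- Let `k` be a field of characteristic zero, `m ≤ n` positive integers and
`φ : k[X_1, …, X_n] → k[X_1, …, X_m]` the homomorphism with `φ(X i) = X i` for `i ≤ m`
and `φ(X i) = 0` otherwise. Then for every ideal `J` and every `c ≥ 0`,
`Δ^c(φ(J)) ⊆ φ(Δ^c(J))` (image ideals). -/
theorem delta_image_le_image_delta
    {k : Type*} [Field k] [CharZero k] (m n : ℕ) (hm : 0 < m) (hmn : m ≤ n)
    (J : Ideal (MvPolynomial (Fin n) k)) (c : ℕ) :
    deltaIdeal^[c] (J.map (projHom k m n)) ≤ (deltaIdeal^[c] J).map (projHom k m n) := by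
  induction c with
  | zero => exact le_rfl
  | succ c ih =>
    rw [Function.iterate_succ_apply', Function.iterate_succ_apply']
    exact (deltaIdeal_mono ih).trans (deltaIdeal_map_projHom_le hmn _)
end

section
/- Let k be a field of characteristic zero, let m ≤ n be positive integers, and let φ : R = k[X_1,…,X_n] → R̄ = k[X_1,…,X_m] be the k-algebra homomorphism with φ(X_i) = X_i for 1 ≤ i ≤ m and φ(X_i) = 0 for m < i ≤ n. Let M = (X_1,…,X_n) ⊂ R and M̄ = (X_1,…,X_m) ⊂ R̄ be the maximal ideals at the origin. Let b ≥ 1 be an integer and let J be an ideal of R with J ⊆ M^b and J ⊄ M^{b+1}, and whose image ideal J̄ = φ(J)·R̄ satisfies J̄ ⊆ M̄^b and J̄ ⊄ M̄^{b+1}. Then there exists an element g ∈ Δ^{b-1}(J) with g ∈ M, g ∉ M^2, φ(g) ∈ M̄ and φ(g) ∉ M̄^2; that is, g has order exactly one at the origin and so does its image φ(g). -/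
namespace MvPolynomial

/-- A partial derivative lowers the order at the origin by at most one. -/
theorem pderiv_mem_idealOfVars_pow {σ R : Type*} [CommRing R] {b : ℕ}
    {p : MvPolynomial σ R} (hp : p ∈ idealOfVars σ R ^ (b + 1)) (i : σ) :
    pderiv i p ∈ idealOfVars σ R ^ b := by
  rw [mem_pow_idealOfVars_iff'] at hp ⊢
  intro d hd
  rw [coeff_pderiv, hp, zero_mul]
  simpa using hd

/-- In characteristic zero, the order at the origin of a polynomial without constant term is
lowered by some partial derivative. -/
theorem exists_pderiv_notMem_idealOfVars_pow {σ R : Type*} [CommRing R] [IsDomain R] [CharZero R]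
    {b : ℕ} {p : MvPolynomial σ R} (hp : p ∈ idealOfVars σ R)
    (hp' : p ∉ idealOfVars σ R ^ (b + 1)) :
    ∃ i, pderiv i p ∉ idealOfVars σ R ^ b := by
  rw [← pow_one (idealOfVars σ R), mem_pow_idealOfVars_iff'] at hp
  rw [mem_pow_idealOfVars_iff'] at hp'
  push Not at hp'
  obtain ⟨d, hd, hcoeff⟩ := hp'
  have hd0 : d ≠ 0 := by
    rintro rfl
    exact hcoeff (hp 0 (by simp))
  obtain ⟨i, hi⟩ := Finsupp.ne_iff.mp hd0
  have hle : Finsupp.single i 1 ≤ d := by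
    simpa [Nat.one_le_iff_ne_zero] using hi
  refine ⟨i, fun hmem ↦ ?_⟩
  rw [mem_pow_idealOfVars_iff'] at hmem
  obtain ⟨e, rfl⟩ := exists_add_of_le hle
  rw [add_comm] at hd hcoeff
  have h := hmem e (by simpa using hd)
  rw [coeff_pderiv] at h
  exact mul_ne_zero hcoeff (Nat.cast_add_one_ne_zero (e i)) h

end MvPolynomial

open MvPolynomial in
theorem projHom_pderiv_castLE {k : Type*} [CommRing k] {m n : ℕ} (hmn : m ≤ n) (i : Fin m)
    (f : MvPolynomial (Fin n) k) :
    projHom k m n (pderiv (Fin.castLE hmn i) f) = pderiv i (projHom k m n f) := by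
  classical
  induction f using MvPolynomial.induction_on with
  | C a => simp [projHom]
  | add p q hp hq => simp [hp, hq]
  | mul_X p j hp =>
    have hX : projHom k m n (pderiv (Fin.castLE hmn i) (X j)) =
        pderiv i (projHom k m n (X j)) := by
      by_cases h : (j : ℕ) < m
      · by_cases hji : (j : ℕ) = i <;>
          simp [projHom, h, pderiv_X, Pi.single_apply, Fin.ext_iff, hji]
      · have hne : j ≠ Fin.castLE hmn i := by
          rintro rfl
          exact h i.isLt
        simp [projHom, h, pderiv_X_of_ne hne]
    rw [pderiv_mul, map_add, map_mul, map_mul, hp, hX, map_mul, pderiv_mul]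

open MvPolynomial in
theorem map_projHom_idealOfVars_le (k : Type*) [CommRing k] (m n : ℕ) :
    (idealOfVars (Fin n) k).map (projHom k m n) ≤ idealOfVars (Fin m) k := by
  rw [idealOfVars, Ideal.map_span, Ideal.span_le]
  rintro _ ⟨_, ⟨j, rfl⟩, rfl⟩
  by_cases h : (j : ℕ) < m
  · simpa [projHom, h] using Ideal.subset_span (Set.mem_range_self _)
  · simp [projHom, h]

open MvPolynomial in
theorem projHom_mem_idealOfVars_pow {k : Type*} [CommRing k] {m n b : ℕ}
    {f : MvPolynomial (Fin n) k} (hf : f ∈ idealOfVars (Fin n) k ^ b) :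
    projHom k m n f ∈ idealOfVars (Fin m) k ^ b := by
  have h := Ideal.mem_map_of_mem (projHom k m n) hf
  rw [Ideal.map_pow] at h
  exact Ideal.pow_right_mono (map_projHom_idealOfVars_le k m n) b h

theorem pderiv_mem_deltaIdeal {k σ : Type*} [CommRing k] {J : Ideal (MvPolynomial σ k)}
    {f : MvPolynomial σ k} (hf : f ∈ J) (i : σ) : MvPolynomial.pderiv i f ∈ deltaIdeal J :=
  Ideal.mem_sup_right (Ideal.subset_span ⟨f, hf, i, rfl⟩)

open MvPolynomial in
/-- Differentiating `b` times in the first `m` variables, an element of order at least `b + 1` whose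
image has order at most `b + 1` yields a non-unit whose image has order at most one. -/
theorem exists_mem_deltaIdeal_iterate {k : Type*} [CommRing k] [IsDomain k] [CharZero k]
    {m n : ℕ} (hmn : m ≤ n) (b : ℕ) {J : Ideal (MvPolynomial (Fin n) k)}
    {f : MvPolynomial (Fin n) k} (hfJ : f ∈ J) (hf : f ∈ idealOfVars (Fin n) k ^ (b + 1))
    (hf' : projHom k m n f ∉ idealOfVars (Fin m) k ^ (b + 2)) :
    ∃ g ∈ deltaIdeal^[b] J, g ∈ idealOfVars (Fin n) k ∧
      projHom k m n g ∉ idealOfVars (Fin m) k ^ 2 := by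
  induction b generalizing J f with
  | zero => exact ⟨f, hfJ, by simpa using hf, hf'⟩
  | succ b ih =>
    obtain ⟨i, hi⟩ := exists_pderiv_notMem_idealOfVars_pow
      (Ideal.pow_le_self (Nat.succ_ne_zero _) (projHom_mem_idealOfVars_pow hf)) hf'
    rw [← projHom_pderiv_castLE hmn] at hi
    exact ih (pderiv_mem_deltaIdeal hfJ _) (pderiv_mem_idealOfVars_pow hf _) hi

/-- Let `k` be a field of characteristic zero, `m ≤ n` positive, `φ` the projection
homomorphism, `M` and `M̄` the maximal ideals at the origin of `k[X_1, …, X_n]` and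
`k[X_1, …, X_m]`. If `b ≥ 1`, `J` has order exactly `b` at the origin
(`J ⊆ M ^ b`, `J ⊄ M ^ (b+1)`) and so does its image ideal `J̄ = φ(J)`
(`J̄ ⊆ M̄ ^ b`, `J̄ ⊄ M̄ ^ (b+1)`), then there is `g ∈ Δ^(b-1)(J)` of order exactly one
at the origin whose image `φ(g)` also has order exactly one at the origin. -/
theorem exists_order_one_element_of_delta
    {k : Type*} [Field k] [CharZero k] (m n : ℕ) (hm : 0 < m) (hmn : m ≤ n)
    (M : Ideal (MvPolynomial (Fin n) k))
    (hM : M = Ideal.span (Set.range (MvPolynomial.X (R := k) (σ := Fin n))))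
    (Mbar : Ideal (MvPolynomial (Fin m) k))
    (hMbar : Mbar = Ideal.span (Set.range (MvPolynomial.X (R := k) (σ := Fin m))))
    (b : ℕ) (hb : 1 ≤ b) (J : Ideal (MvPolynomial (Fin n) k))
    (hJM : J ≤ M ^ b) (hJM' : ¬ J ≤ M ^ (b + 1))
    (hJbar : J.map (projHom k m n) ≤ Mbar ^ b)
    (hJbar' : ¬ J.map (projHom k m n) ≤ Mbar ^ (b + 1)) :
    ∃ g ∈ deltaIdeal^[b - 1] J,
      g ∈ M ∧ g ∉ M ^ 2 ∧ projHom k m n g ∈ Mbar ∧ projHom k m n g ∉ Mbar ^ 2 := by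
  obtain ⟨b, rfl⟩ := Nat.exists_eq_add_of_le' hb
  change M = MvPolynomial.idealOfVars (Fin n) k at hM
  change Mbar = MvPolynomial.idealOfVars (Fin m) k at hMbar
  subst hM hMbar
  rw [Ideal.map_le_iff_le_comap] at hJbar'
  obtain ⟨f, hfJ, hf⟩ := SetLike.not_le_iff_exists.mp hJbar'
  obtain ⟨g, hgJ, hg, hg'⟩ := exists_mem_deltaIdeal_iterate hmn b hfJ (hJM hfJ) hf
  refine ⟨g, hgJ, hg, fun h ↦ hg' (projHom_mem_idealOfVars_pow h), ?_, hg'⟩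
  exact map_projHom_idealOfVars_le k m n (Ideal.mem_map_of_mem _ hg)
end

section
/- Let k be a field of characteristic zero, let R = k[X_1,…,X_n] be the polynomial ring, let J be a nonzero ideal of R and b ≥ 1 an integer. Then the set Sing(J,b) of all prime ideals P of R such that J·R_P ⊆ (P·R_P)^b (the primes at which the order of J is at least b) is a closed subset of Spec R in the Zariski topology: it equals the zero locus V(Δ^{b-1}(J)) of the ideal Δ^{b-1}(J). -/
open IsLocalRing MvPolynomial

section

variable {k : Type*} [Field k] {σ : Type*} (P : Ideal (MvPolynomial σ k)) [P.IsPrime]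

/-- The `m`-th symbolic power of the prime `P` of a polynomial ring: the contraction of the `m`-th
power of the maximal ideal of the localization at `P`. -/
noncomputable def symbolicPower (m : ℕ) : Ideal (MvPolynomial σ k) :=
  ((maximalIdeal (Localization.AtPrime P)) ^ m).comap (algebraMap _ (Localization.AtPrime P))

variable {P}

theorem mem_symbolicPower_iff {m : ℕ} {f : MvPolynomial σ k} :
    f ∈ symbolicPower P m ↔
      algebraMap _ (Localization.AtPrime P) f ∈ (maximalIdeal (Localization.AtPrime P)) ^ m :=
  Iff.rfl

theorem symbolicPower_one : symbolicPower P 1 = P := by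
  rw [symbolicPower, pow_one]
  exact Localization.AtPrime.under_maximalIdeal

theorem symbolicPower_succ_le (m : ℕ) : symbolicPower P (m + 1) ≤ symbolicPower P m :=
  Ideal.comap_mono (Ideal.pow_le_pow_right m.le_succ)

theorem mem_symbolicPower_iff_exists {m : ℕ} {f : MvPolynomial σ k} :
    f ∈ symbolicPower P m ↔ ∃ s ∉ P, s * f ∈ P ^ m := by
  rw [mem_symbolicPower_iff, ← IsLocalization.AtPrime.map_eq_maximalIdeal P, ← Ideal.map_pow,
    IsLocalization.algebraMap_mem_map_algebraMap_iff P.primeCompl]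
  rfl

theorem map_le_pow_iff_le_symbolicPower {J : Ideal (MvPolynomial σ k)} {m : ℕ} :
    J.map (algebraMap _ (Localization.AtPrime P)) ≤
      (P.map (algebraMap _ (Localization.AtPrime P))) ^ m ↔ J ≤ symbolicPower P m := by
  rw [IsLocalization.AtPrime.map_eq_maximalIdeal P, Ideal.map_le_iff_le_comap, symbolicPower]

theorem Derivation.apply_mem_pow {R A : Type*} [CommRing R] [CommRing A] [Algebra R A]
    (D : Derivation R A A) {I : Ideal A} {m : ℕ} {f : A} (hf : f ∈ I ^ (m + 1)) :
    D f ∈ I ^ m := by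
  induction m generalizing f with
  | zero => simp
  | succ m ih =>
    rw [pow_succ] at hf
    induction hf using Submodule.mul_induction_on' with
    | mem_mul_mem x hx y hy =>
      rw [D.leibniz, smul_eq_mul, smul_eq_mul]
      refine add_mem (Ideal.mul_mem_right _ _ hx) ?_
      rw [mul_comm, pow_succ]
      exact Ideal.mul_mem_mul (ih hx) hy
    | add x _ y _ hx hy => rw [map_add]; exact add_mem hx hy

theorem pderiv_mem_symbolicPower {m : ℕ} {f : MvPolynomial σ k} (i : σ)
    (hf : f ∈ symbolicPower P (m + 1)) : pderiv i f ∈ symbolicPower P m := by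
  obtain ⟨s, hs, hsf⟩ := mem_symbolicPower_iff_exists.1 hf
  refine mem_symbolicPower_iff_exists.2 ⟨s * s, ?_, ?_⟩
  · exact fun h ↦ hs ((Ideal.IsPrime.mem_or_mem ‹_› h).elim id id)
  · have h : s * s * pderiv i f = s * pderiv i (s * f) - pderiv i s * (s * f) := by
      rw [Derivation.leibniz, smul_eq_mul, smul_eq_mul]; ring
    rw [h]
    exact sub_mem (Ideal.mul_mem_left _ _ (Derivation.apply_mem_pow _ hsf))
      (Ideal.mul_mem_left _ _ (Ideal.pow_le_pow_right m.le_succ hsf))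

theorem mkDerivation_apply_eq_sum [Fintype σ] {A : Type*} [AddCommGroup A] [Module k A]
    [Module (MvPolynomial σ k) A] [IsScalarTower k (MvPolynomial σ k) A]
    (a : σ → A) (f : MvPolynomial σ k) :
    mkDerivation k a f = ∑ i, pderiv i f • a i := by
  classical
  induction f using MvPolynomial.induction_on with
  | C r => simp
  | add p q hp hq => simp [hp, hq, add_smul, Finset.sum_add_distrib]
  | mul_X p j hp =>
    rw [Derivation.leibniz, hp, mkDerivation_X, Finset.smul_sum]
    simp only [Derivation.leibniz, pderiv_X, add_smul, Finset.sum_add_distrib, smul_assoc,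
      Pi.single_apply]
    simp

/-- If the residue field of a local `k`-algebra `S` is formally smooth over `k`, then for every
`k`-algebra map `ι` from a polynomial ring to `S` there is a derivation along `ι` with values in
the maximal ideal that agrees with `ι` modulo the square of the maximal ideal on all polynomials
which `ι` maps to the maximal ideal. -/
theorem exists_euler_coefficients_of_formallySmooth {S : Type*} [CommRing S] [IsLocalRing S]
    [Algebra k S] [Algebra.FormallySmooth k (ResidueField S)] [Algebra (MvPolynomial σ k) S]
    [IsScalarTower k (MvPolynomial σ k) S] :
    ∃ a : σ → S, (∀ i, a i ∈ maximalIdeal S) ∧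
      ∀ f : MvPolynomial σ k, algebraMap _ S f ∈ maximalIdeal S →
        mkDerivation k a f - algebraMap _ S f ∈ maximalIdeal S ^ 2 := by
  let q : S →ₐ[k] S ⧸ maximalIdeal S ^ 2 := Ideal.Quotient.mkₐ k _
  let g : (S ⧸ maximalIdeal S ^ 2) →ₐ[k] ResidueField S :=
    Ideal.Quotient.factorₐ k (Ideal.pow_le_self two_ne_zero)
  have hg : Function.Surjective g :=
    Ideal.Quotient.factor_surjective (Ideal.pow_le_self two_ne_zero)
  have hqg (x : S) : g (q x) = residue S x := rfl
  have hker (x y) (hx : g x = 0) (hy : g y = 0) : x * y = 0 := by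
    obtain ⟨x, rfl⟩ := Ideal.Quotient.mk_surjective x
    obtain ⟨y, rfl⟩ := Ideal.Quotient.mk_surjective y
    rw [← map_mul, Ideal.Quotient.eq_zero_iff_mem, pow_two]
    exact Ideal.mul_mem_mul ((residue_eq_zero_iff x).1 hx) ((residue_eq_zero_iff y).1 hy)
  have hnil : IsNilpotent (RingHom.ker (g : (S ⧸ maximalIdeal S ^ 2) →+* ResidueField S)) := by
    refine ⟨2, ?_⟩
    rw [pow_two (RingHom.ker _), Ideal.zero_eq_bot, eq_bot_iff, Ideal.mul_le]
    exact fun x hx y hy ↦ hker x y hx hy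
  obtain ⟨s, hs⟩ : ∃ s : ResidueField S →ₐ[k] S ⧸ maximalIdeal S ^ 2, ∀ x, g (s x) = x :=
    ⟨_, Algebra.FormallySmooth.liftOfSurjective_apply (AlgHom.id k (ResidueField S)) g hg hnil⟩
  have hgt (x : S) : g (q x - s (residue S x)) = 0 := by rw [map_sub, hqg, hs, sub_self]
  let ι : MvPolynomial σ k →ₐ[k] S := IsScalarTower.toAlgHom k _ S
  have key (x : S) : ∃ y, q y = q x - s (residue S x) := Ideal.Quotient.mk_surjective _
  choose a ha using fun i ↦ key (ι (X i))
  have hφ (f : MvPolynomial σ k) :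
      q (mkDerivation k a f) = q (ι f) - s (residue S (ι f)) := by
    induction f using MvPolynomial.induction_on with
    | C r =>
      have h1 : ι (C r) = algebraMap k S r := ι.commutes r
      have h2 : residue S (algebraMap k S r) = algebraMap k _ r := rfl
      rw [h1, h2, AlgHom.commutes, AlgHom.commutes, sub_self, derivation_C, map_zero]
    | add x y hx hy => simp only [map_add, hx, hy]; ring
    | mul_X x i hx =>
      have h0 := hker _ _ (hgt (ι x)) (hgt (ι (X i)))
      have h1 : mkDerivation k a (x * X i) = ι x * a i + ι (X i) * mkDerivation k a x := by
        rw [Derivation.leibniz, mkDerivation_X, Algebra.smul_def, Algebra.smul_def]; rfl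
      rw [h1, map_add, map_mul, map_mul, hx, ha, map_mul, map_mul, map_mul, map_mul]
      linear_combination h0
  refine ⟨a, fun i ↦ ?_, fun f hf ↦ ?_⟩
  · rw [← residue_eq_zero_iff, ← hqg, ha, hgt]
  · rw [← Ideal.Quotient.eq_zero_iff_mem]
    change q (mkDerivation k a f - ι f) = 0
    have h : residue S (ι f) = 0 := (residue_eq_zero_iff _).2 hf
    rw [map_sub, hφ, h, map_zero, sub_zero, sub_self]

theorem exists_euler_coefficients [CharZero k] [Finite σ] (P : Ideal (MvPolynomial σ k))
    [P.IsPrime] :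
    ∃ a : σ → Localization.AtPrime P, (∀ i, a i ∈ maximalIdeal (Localization.AtPrime P)) ∧
      ∀ f ∈ P, mkDerivation k a f - algebraMap _ (Localization.AtPrime P) f ∈
        (maximalIdeal (Localization.AtPrime P)) ^ 2 := by
  have : Algebra.EssFiniteType k (Localization.AtPrime P) :=
    Algebra.EssFiniteType.comp k (MvPolynomial σ k) _
  have : Algebra.EssFiniteType k (ResidueField (Localization.AtPrime P)) :=
    Algebra.EssFiniteType.comp k (Localization.AtPrime P) _
  obtain ⟨a, ha, h⟩ :=
    exists_euler_coefficients_of_formallySmooth (k := k) (σ := σ) (S := Localization.AtPrime P)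
  exact ⟨a, ha, fun f hf ↦ h f ((IsLocalization.AtPrime.to_map_mem_maximal_iff _ P f).2 hf)⟩

/-- Euler's identity modulo higher order terms. -/
theorem euler_identity {a : σ → Localization.AtPrime P}
    (ha : ∀ f ∈ P, mkDerivation k a f - algebraMap _ (Localization.AtPrime P) f ∈
        (maximalIdeal (Localization.AtPrime P)) ^ 2)
    {m : ℕ} {f : MvPolynomial σ k} (hf : f ∈ P ^ (m + 1)) :
    mkDerivation k a f - (m + 1 : ℕ) * algebraMap _ (Localization.AtPrime P) f ∈
      (maximalIdeal (Localization.AtPrime P)) ^ (m + 2) := by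
  have hP (n : ℕ) {x : MvPolynomial σ k} (hx : x ∈ P ^ n) :
      algebraMap _ (Localization.AtPrime P) x ∈ maximalIdeal (Localization.AtPrime P) ^ n := by
    rw [← IsLocalization.AtPrime.map_eq_maximalIdeal P, ← Ideal.map_pow]
    exact Ideal.mem_map_of_mem _ hx
  induction m generalizing f with
  | zero => simpa using ha f (by simpa using hf)
  | succ m ih =>
    rw [pow_succ] at hf
    induction hf using Submodule.mul_induction_on' with
    | mem_mul_mem x hx y hy =>
      have h1 := Ideal.mul_mem_mul (hP _ hx) (ha y hy)
      have h2 := Ideal.mul_mem_mul (ih hx) (hP 1 (by simpa using hy))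
      rw [← pow_add] at h1 h2
      convert add_mem h1 h2 using 1
      rw [Derivation.leibniz, Algebra.smul_def, Algebra.smul_def, map_mul]
      push_cast
      ring
    | add x _ y _ hx hy =>
      convert add_mem hx hy using 1
      simp only [map_add]
      ring

theorem mem_symbolicPower_succ [CharZero k] [Finite σ] {m : ℕ} {f : MvPolynomial σ k}
    (hf : f ∈ symbolicPower P (m + 1)) (hd : ∀ i, pderiv i f ∈ symbolicPower P (m + 1)) :
    f ∈ symbolicPower P (m + 2) := by
  have := Fintype.ofFinite σ
  obtain ⟨a, ha, hE⟩ := exists_euler_coefficients P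
  obtain ⟨s, hs, hsf⟩ := mem_symbolicPower_iff_exists.1 hf
  rw [mem_symbolicPower_iff] at hf ⊢
  have hφ {g : MvPolynomial σ k} : mkDerivation k a g ∈ maximalIdeal (Localization.AtPrime P) := by
    rw [mkDerivation_apply_eq_sum]
    exact sum_mem fun i _ ↦ Submodule.smul_of_tower_mem _ _ (ha i)
  have hφf : mkDerivation k a f ∈ maximalIdeal (Localization.AtPrime P) ^ (m + 2) := by
    rw [mkDerivation_apply_eq_sum]
    refine sum_mem fun i _ ↦ ?_
    rw [Algebra.smul_def, pow_succ]
    exact Ideal.mul_mem_mul (hd i) (ha i)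
  have h := euler_identity hE hsf
  have hfs := Ideal.mul_mem_mul hf (hφ (g := s))
  rw [← pow_succ] at hfs
  have hms : ((m + 1 : ℕ) * algebraMap _ (Localization.AtPrime P) s) *
      algebraMap _ (Localization.AtPrime P) f ∈
      maximalIdeal (Localization.AtPrime P) ^ (m + 2) := by
    convert sub_mem (add_mem (Ideal.mul_mem_left _
      (algebraMap _ (Localization.AtPrime P) s) hφf) hfs) h using 1
    rw [Derivation.leibniz, Algebra.smul_def, Algebra.smul_def, map_mul]
    ring
  refine (Ideal.unit_mul_mem_iff_mem _ (IsUnit.mul ?_ ?_)).1 hms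
  · rw [← map_natCast (algebraMap k (Localization.AtPrime P))]
    exact (IsUnit.mk0 _ (Nat.cast_ne_zero.2 m.succ_ne_zero)).map _
  · exact IsLocalization.map_units (Localization.AtPrime P) (⟨s, hs⟩ : P.primeCompl)

theorem deltaIdeal_le_symbolicPower_iff [CharZero k] [Finite σ] {J : Ideal (MvPolynomial σ k)}
    {m : ℕ} : deltaIdeal J ≤ symbolicPower P (m + 1) ↔ J ≤ symbolicPower P (m + 2) := by
  rw [deltaIdeal, sup_le_iff, Ideal.span_le]
  constructor
  · rintro ⟨h, h'⟩ f hf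
    exact mem_symbolicPower_succ (h hf) fun i ↦ h' ⟨f, hf, i, rfl⟩
  · intro h
    refine ⟨h.trans (symbolicPower_succ_le _), ?_⟩
    rintro _ ⟨f, hf, i, rfl⟩
    exact pderiv_mem_symbolicPower i (h hf)

theorem deltaIdeal_iterate_le_iff [CharZero k] [Finite σ] {J : Ideal (MvPolynomial σ k)} {c : ℕ} :
    deltaIdeal^[c] J ≤ P ↔ J ≤ symbolicPower P (c + 1) := by
  induction c generalizing J with
  | zero => rw [Function.iterate_zero_apply, zero_add, symbolicPower_one]
  | succ c ih => rw [Function.iterate_succ_apply, ih, deltaIdeal_le_symbolicPower_iff]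

end

/-- Let `k` be a field of characteristic zero, `R = k[X_1, …, X_n]`, `J` a nonzero ideal
of `R` and `b ≥ 1`. Then `Sing(J, b)`, the set of primes `P` at which the order of `J`
is at least `b` (i.e. `J·R_P ⊆ (P·R_P) ^ b`), equals the zero locus `V(Δ^(b-1)(J))`;
in particular it is Zariski closed in `Spec R`. -/
theorem sing_eq_zeroLocus_delta_and_isClosed
    {k : Type*} [Field k] [CharZero k] (n : ℕ)
    (J : Ideal (MvPolynomial (Fin n) k)) (hJ : J ≠ ⊥) (b : ℕ) (hb : 1 ≤ b) :
    {P : PrimeSpectrum (MvPolynomial (Fin n) k) |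
        J.map (algebraMap (MvPolynomial (Fin n) k) (Localization.AtPrime P.asIdeal)) ≤
          (P.asIdeal.map (algebraMap (MvPolynomial (Fin n) k)
            (Localization.AtPrime P.asIdeal))) ^ b} =
        PrimeSpectrum.zeroLocus (deltaIdeal^[b - 1] J : Set (MvPolynomial (Fin n) k)) ∧
      IsClosed {P : PrimeSpectrum (MvPolynomial (Fin n) k) |
        J.map (algebraMap (MvPolynomial (Fin n) k) (Localization.AtPrime P.asIdeal)) ≤
          (P.asIdeal.map (algebraMap (MvPolynomial (Fin n) k)
            (Localization.AtPrime P.asIdeal))) ^ b} := by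
  rw [and_iff_left_of_imp fun h ↦ h ▸ PrimeSpectrum.isClosed_zeroLocus _]
  obtain ⟨c, rfl⟩ := Nat.exists_eq_add_of_le' hb
  ext P
  rw [Set.mem_ofPred_eq, map_le_pow_iff_le_symbolicPower, Nat.add_sub_cancel,
    ← deltaIdeal_iterate_le_iff, PrimeSpectrum.mem_zeroLocus, SetLike.coe_subset_coe]
end
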